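/- Let K ≥ 1, and for each k ∈ {1,…,K} let V^{(k)} ∈ ℝ^{C×D} have no zero entries and pairwise distinct entries in its d-th column, and let a^{(k)} ∈ ℝ^C. Let x' ∈ ℝ^D with x'_d ≠ 0, and define the class-variance score u(x) = (1/C) Σ_{c=1}^{C} [ (1/K) Σ_{k=1}^{K} (softmax(V^{(k)} x + a^{(k)})_c)^2 − ( (1/K) Σ_{k=1}^{K} softmax(V^{(k)} x + a^{(k)})_c )^2 ]. Then the Euclidean norm of the gradient of u evaluated at the scaled point x_α tends to 0 as α → ∞. -/

import Mathlib

/-- The softmax function on `ℝ^C`. -/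
noncomputable def softmax {C : ℕ} (z : Fin C → ℝ) : Fin C → ℝ :=
  fun c => Real.exp (z c) / ∑ c', Real.exp (z c')

/-- The point `x'` scaled by `α` in coordinate `d` (all other coordinates unchanged). -/
def scaled {D : ℕ} (x' : Fin D → ℝ) (d : Fin D) (α : ℝ) : Fin D → ℝ :=
  Function.update x' d (α * x' d)

open Filter Topology

/-- A bounded differentiable real function whose derivative vanishes along `p` in the limit `l`. -/
structure FDerivVanishesAlong {E ι : Type*} [NormedAddCommGroup E] [NormedSpace ℝ E]
    (p : ι → E) (l : Filter ι) (f : E → ℝ) : Prop where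
  differentiable : Differentiable ℝ f
  bounded : ∃ B, ∀ x, ‖f x‖ ≤ B
  tendsto : Tendsto (fun t => fderiv ℝ f (p t)) l (𝓝 0)

namespace FDerivVanishesAlong

variable {E ι : Type*} [NormedAddCommGroup E] [NormedSpace ℝ E]
  {p : ι → E} {l : Filter ι} {f g : E → ℝ}

theorem const (r : ℝ) : FDerivVanishesAlong p l fun _ : E => r where
  differentiable := differentiable_const r
  bounded := ⟨‖r‖, fun _ => le_rfl⟩
  tendsto := by simpa using tendsto_const_nhds

theorem add (hf : FDerivVanishesAlong p l f) (hg : FDerivVanishesAlong p l g) :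
    FDerivVanishesAlong p l fun x => f x + g x where
  differentiable := hf.differentiable.add hg.differentiable
  bounded := by
    obtain ⟨A, hA⟩ := hf.bounded
    obtain ⟨B, hB⟩ := hg.bounded
    exact ⟨A + B, fun x => norm_add_le_of_le (hA x) (hB x)⟩
  tendsto := by
    have h := hf.tendsto.add hg.tendsto
    rw [add_zero] at h
    exact h.congr fun t => (fderiv_fun_add (hf.differentiable _) (hg.differentiable _)).symm

theorem mul (hf : FDerivVanishesAlong p l f) (hg : FDerivVanishesAlong p l g) :
    FDerivVanishesAlong p l fun x => f x * g x where
  differentiable := hf.differentiable.mul hg.differentiable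
  bounded := by
    obtain ⟨A, hA⟩ := hf.bounded
    obtain ⟨B, hB⟩ := hg.bounded
    exact ⟨A * B, fun x => norm_mul_le_of_le (hA x) (hB x)⟩
  tendsto := by
    have key : ∀ {u v : E → ℝ}, (∃ B, ∀ x, ‖u x‖ ≤ B) →
        Tendsto (fun t => fderiv ℝ v (p t)) l (𝓝 0) →
        Tendsto (fun t => u (p t) • fderiv ℝ v (p t)) l (𝓝 0) := by
      rintro u v ⟨B, hB⟩ hv
      refine squeeze_zero_norm (a := fun t => B * ‖fderiv ℝ v (p t)‖) (fun t => ?_) ?_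
      · rw [norm_smul]
        gcongr
        exact hB _
      · simpa using hv.norm.const_mul B
    have h := (key hf.bounded hg.tendsto).add (key hg.bounded hf.tendsto)
    rw [add_zero] at h
    exact h.congr fun t => (fderiv_fun_mul (hf.differentiable _) (hg.differentiable _)).symm

theorem sub (hf : FDerivVanishesAlong p l f) (hg : FDerivVanishesAlong p l g) :
    FDerivVanishesAlong p l fun x => f x - g x := by
  simpa [sub_eq_add_neg] using hf.add ((const (-1)).mul hg)

theorem sq (hf : FDerivVanishesAlong p l f) : FDerivVanishesAlong p l fun x => f x ^ 2 := by
  simpa [pow_two] using hf.mul hf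

theorem sum {κ : Type*} (s : Finset κ) {F : κ → E → ℝ}
    (hF : ∀ i ∈ s, FDerivVanishesAlong p l (F i)) :
    FDerivVanishesAlong p l fun x => ∑ i ∈ s, F i x := by
  classical
  induction s using Finset.induction_on with
  | empty => simpa using const 0
  | insert i s hi ih =>
    simp only [Finset.sum_insert hi]
    exact (hF i (s.mem_insert_self i)).add (ih fun j hj => hF j (Finset.mem_insert_of_mem hj))

end FDerivVanishesAlong

theorem softmax_eq_inv_sum {C : ℕ} (z : Fin C → ℝ) (c : Fin C) :
    softmax z c = (∑ j, Real.exp (z j - z c))⁻¹ := by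
  simp only [softmax, Real.exp_sub, ← Finset.sum_div, inv_div]

theorem softmax_nonneg {C : ℕ} (z : Fin C → ℝ) (c : Fin C) : 0 ≤ softmax z c := by
  unfold softmax
  positivity

theorem one_add_exp_sub_le_sum {C : ℕ} (z : Fin C → ℝ) {c j : Fin C} (h : j ≠ c) :
    1 + Real.exp (z j - z c) ≤ ∑ i, Real.exp (z i - z c) := by
  have := Finset.sum_le_univ_sum_of_nonneg (s := {c, j}) (f := fun i => Real.exp (z i - z c))
    fun i => (Real.exp_pos _).le
  simpa [Finset.sum_pair h.symm] using this

theorem exp_div_one_add_exp_sq_le (w : ℝ) :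
    Real.exp w / (1 + Real.exp w) ^ 2 ≤ Real.exp (-|w|) := by
  have hw := Real.exp_pos w
  rw [div_le_iff₀ (by positivity)]
  rcases abs_cases w with ⟨h, -⟩ | ⟨h, -⟩ <;> rw [h]
  · rw [Real.exp_neg, inv_mul_eq_div, le_div_iff₀ hw]
    nlinarith
  · rw [neg_neg]
    nlinarith [mul_pos hw hw, mul_pos hw (mul_pos hw hw)]

theorem softmax_le_one {C : ℕ} (z : Fin C → ℝ) (c : Fin C) : softmax z c ≤ 1 := by
  unfold softmax
  refine div_le_one_of_le₀ ?_ (by positivity)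
  exact Finset.single_le_sum (f := fun i => Real.exp (z i)) (fun i _ => (Real.exp_pos _).le)
    (Finset.mem_univ c)

section Affine

variable {E ι : Type*} [NormedAddCommGroup E] [NormedSpace ℝ E] {C : ℕ}

theorem hasFDerivAt_softmax_affine (L : Fin C → E →L[ℝ] ℝ) (b : Fin C → ℝ) (c : Fin C) (x : E) :
    HasFDerivAt (fun x => softmax (fun j => L j x + b j) c)
      (-((∑ j, Real.exp (L j x + b j - (L c x + b c))) ^ 2)⁻¹ •
        ∑ j, Real.exp (L j x + b j - (L c x + b c)) • (L j - L c)) x := by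
  simp only [softmax_eq_inv_sum]
  have hsum : HasFDerivAt (fun x => ∑ j, Real.exp (L j x + b j - (L c x + b c)))
      (∑ j, Real.exp (L j x + b j - (L c x + b c)) • (L j - L c)) x :=
    HasFDerivAt.fun_sum fun j _ =>
      (((L j).hasFDerivAt.add_const (b j)).sub ((L c).hasFDerivAt.add_const (b c))).exp
  have hpos : 0 < ∑ j, Real.exp (L j x + b j - (L c x + b c)) :=
    Finset.sum_pos (fun j _ => Real.exp_pos _) ⟨c, Finset.mem_univ c⟩
  exact (hasDerivAt_inv hpos.ne').comp_hasFDerivAt x hsum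

theorem fderivVanishesAlong_softmax_affine {p : ι → E} {l : Filter ι} (L : Fin C → E →L[ℝ] ℝ)
    (b : Fin C → ℝ) (c : Fin C)
    (h : ∀ j, j ≠ c → Tendsto (fun t => |L j (p t) + b j - (L c (p t) + b c)|) l atTop) :
    FDerivVanishesAlong p l fun x => softmax (fun j => L j x + b j) c where
  differentiable x := (hasFDerivAt_softmax_affine L b c x).differentiableAt
  bounded := ⟨1, fun x => by
    rw [Real.norm_of_nonneg (softmax_nonneg _ _)]
    exact softmax_le_one _ _⟩
  tendsto := by
    simp only [(hasFDerivAt_softmax_affine L b c _).fderiv, Finset.smul_sum, smul_smul]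
    rw [← Finset.sum_const_zero (s := (Finset.univ : Finset (Fin C)))]
    refine tendsto_finsetSum _ fun j _ => ?_
    rcases eq_or_ne j c with rfl | hj
    · simpa using tendsto_const_nhds
    refine squeeze_zero_norm
      (a := fun t => Real.exp (-|L j (p t) + b j - (L c (p t) + b c)|) * ‖L j - L c‖)
      (fun t => ?_) ?_
    · rw [norm_smul]
      gcongr
      have hle := one_add_exp_sub_le_sum (fun i => L i (p t) + b i) hj
      refine le_trans ?_ (exp_div_one_add_exp_sq_le _)
      rw [neg_mul, norm_neg, Real.norm_of_nonneg (by positivity), inv_mul_eq_div]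
      gcongr
    · simpa using
        (Real.tendsto_exp_neg_atTop_nhds_zero.comp (h j hj)).mul_const ‖L j - L c‖

end Affine

theorem sum_mul_scaled {D : ℕ} (v x' : Fin D → ℝ) (d : Fin D) (α : ℝ) :
    ∑ i, v i * scaled x' d α i = α * (v d * x' d) + ∑ i ∈ Finset.univ.erase d, v i * x' i := by
  rw [← Finset.add_sum_erase _ _ (Finset.mem_univ d)]
  congr 1
  · simp only [scaled, Function.update_self]
    ring
  · refine Finset.sum_congr rfl fun i hi => ?_
    rw [scaled, Function.update_of_ne (Finset.ne_of_mem_erase hi)]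

theorem tendsto_abs_mul_add_atTop {m : ℝ} (hm : m ≠ 0) (r : ℝ) :
    Tendsto (fun α : ℝ => |α * m + r|) atTop atTop := by
  rcases hm.lt_or_gt with h | h
  · exact tendsto_abs_atBot_atTop.comp
      (tendsto_atBot_add_const_right _ r (tendsto_id.atTop_mul_const_of_neg h))
  · exact tendsto_abs_atTop_atTop.comp
      (tendsto_atTop_add_const_right _ r (tendsto_id.atTop_mul_const h))

theorem fderivVanishesAlong_softmax_mulVec_scaled {C D : ℕ} (V : Matrix (Fin C) (Fin D) ℝ)
    (a : Fin C → ℝ) (d : Fin D) (hcol : Function.Injective fun c => V c d)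
    (x' : Fin D → ℝ) (hx' : x' d ≠ 0) (c : Fin C) :
    FDerivVanishesAlong (fun α : ℝ => (WithLp.equiv 2 (Fin D → ℝ)).symm (scaled x' d α)) atTop
      fun x : EuclideanSpace ℝ (Fin D) =>
        softmax (V.mulVec (WithLp.equiv 2 (Fin D → ℝ) x) + a) c := by
  let L : Fin C → EuclideanSpace ℝ (Fin D) →L[ℝ] ℝ :=
    fun j => ∑ i, V j i • EuclideanSpace.proj (𝕜 := ℝ) i
  have hL : ∀ j x, L j x = ∑ i, V j i * x i := fun j x => by simp [L]
  have hz : ∀ x : EuclideanSpace ℝ (Fin D),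
      V.mulVec (WithLp.equiv 2 (Fin D → ℝ) x) + a = fun j => L j x + a j := fun x => by
    funext j
    simp [hL, Matrix.mulVec, dotProduct]
  simp only [hz]
  refine fderivVanishesAlong_softmax_affine L a c fun j hj => ?_
  have hm : (V j d - V c d) * x' d ≠ 0 := mul_ne_zero (sub_ne_zero.2 (hcol.ne hj)) hx'
  refine (tendsto_abs_mul_add_atTop hm ((∑ i ∈ Finset.univ.erase d, V j i * x' i) + a j -
    ((∑ i ∈ Finset.univ.erase d, V c i * x' i) + a c))).congr fun α => ?_
  simp only [hL, WithLp.equiv_symm_apply, sum_mul_scaled]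
  congr 1
  ring

theorem stmt_6 (D C K : ℕ) (hC : 1 ≤ C) (hK : 1 ≤ K)
    (V : Fin K → Matrix (Fin C) (Fin D) ℝ) (a : Fin K → Fin C → ℝ) (d : Fin D)
    (hV : ∀ k c d', V k c d' ≠ 0)
    (hcol : ∀ k, Function.Injective fun c => V k c d)
    (x' : Fin D → ℝ) (hx' : x' d ≠ 0) :
    Filter.Tendsto
      (fun α : ℝ =>
        ‖gradient
            (fun x : EuclideanSpace ℝ (Fin D) =>
              (1 / (C : ℝ)) *
                ∑ c : Fin C,
                  ((1 / (K : ℝ)) *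
                      ∑ k : Fin K,
                        (softmax ((V k).mulVec (WithLp.equiv 2 (Fin D → ℝ) x) + a k) c) ^ 2 -
                    ((1 / (K : ℝ)) *
                        ∑ k : Fin K,
                          softmax ((V k).mulVec (WithLp.equiv 2 (Fin D → ℝ) x) + a k) c) ^ 2))
            ((WithLp.equiv 2 (Fin D → ℝ)).symm (scaled x' d α))‖)
      Filter.atTop (nhds 0) := by
  have hs := fun k c => fderivVanishesAlong_softmax_mulVec_scaled (V k) (a k) d (hcol k) x' hx' c
  have hu := (FDerivVanishesAlong.const (1 / (C : ℝ))).mul <|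
    FDerivVanishesAlong.sum Finset.univ fun c _ =>
      ((FDerivVanishesAlong.const (1 / (K : ℝ))).mul
        (FDerivVanishesAlong.sum Finset.univ fun k _ => (hs k c).sq)).sub
      ((FDerivVanishesAlong.const (1 / (K : ℝ))).mul
        (FDerivVanishesAlong.sum Finset.univ fun k _ => hs k c)).sq
  simpa only [gradient, LinearIsometryEquiv.norm_map, norm_zero] using hu.tendsto.norm
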